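/- Let P_A = OPT ∩ HAR, and let P_B be the set of packets p ∈ OPT \ HAR such that at the time p arrives, the occupancy of p's destination queue in Harmonic's buffer is strictly greater than the occupancy of p's destination queue in OPT's buffer. Then there exists an injective map f from P_A ∪ P_B into HAR such that f is the identity on P_A, and for every p ∈ P_B, the packet f(p) has the same destination port as p and arrived strictly before p. -/

import Mathlib

open scoped Classical

noncomputable section

/-! ## Model of online buffer sharing

A switch has `n` output ports and a shared buffer of capacity `B`.
An arrival sequence consists of `m` packets; packet `i : Fin m` arrives at time
`t i : ℕ` and is destined to output port `dest i : Fin n`.  Packets are totally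
ordered by their arrival, and we assume the index order refines the arrival-time
order (`Monotone t`).  An acceptance policy is identified with the set
`S : Finset (Fin m)` of packets it accepts.  Accepted packets join the FIFO queue
of their destination port, and at each integer time `s = 1, 2, …` every nonempty
queue transmits (removes) one packet. -/

/-- Number of packets of `S` destined to `q`, arriving at time `s`, with index `< i`. -/
def arrivalsBefore (m n : ℕ) (t : Fin m → ℕ) (dest : Fin m → Fin n)
    (S : Finset (Fin m)) (q : Fin n) (s : ℕ) (i : ℕ) : ℕ :=
  Set.ncard {j : Fin m | j ∈ S ∧ dest j = q ∧ t j = s ∧ (j : ℕ) < i}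

/-- Number of packets of `S` destined to `q` arriving at time `s`. -/
def arrivalsAt (m n : ℕ) (t : Fin m → ℕ) (dest : Fin m → Fin n)
    (S : Finset (Fin m)) (q : Fin n) (s : ℕ) : ℕ :=
  arrivalsBefore m n t dest S q s m

/-- Occupancy of queue `q` under acceptance set `S` at the end of integer time
step `s`: at each integer time `s ≥ 1` the queue first transmits one packet
(if nonempty), then the packets arriving at time `s` join the queue. -/
def lenAt (m n : ℕ) (t : Fin m → ℕ) (dest : Fin m → Fin n)
    (S : Finset (Fin m)) (q : Fin n) : ℕ → ℕ
  | 0 => arrivalsAt m n t dest S q 0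
  | s + 1 => (lenAt m n t dest S q s - 1) + arrivalsAt m n t dest S q (s + 1)

/-- Occupancy of queue `q` under acceptance set `S` at the moment packet `i`
arrives (just before the decision on `i` is made): packets arriving at the same
time are processed in index order. -/
def occ (m n : ℕ) (t : Fin m → ℕ) (dest : Fin m → Fin n)
    (S : Finset (Fin m)) (i : Fin m) (q : Fin n) : ℕ :=
  if t i = 0 then arrivalsBefore m n t dest S q 0 (i : ℕ)
  else (lenAt m n t dest S q (t i - 1) - 1) + arrivalsBefore m n t dest S q (t i) (i : ℕ)

/-- A policy (acceptance set) is feasible if the shared buffer capacity `B` is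
never exceeded, i.e. right after any acceptance the total occupancy is `≤ B`. -/
def Feasible (m n B : ℕ) (t : Fin m → ℕ) (dest : Fin m → Fin n)
    (S : Finset (Fin m)) : Prop :=
  ∀ i ∈ S, (∑ q : Fin n, occ m n t dest S i q) + 1 ≤ B

/-- The thresholds of the Harmonic policy: `T k = (B / (1 + ln n)) · (1 / k)`. -/
def thr (n B : ℕ) (k : ℕ) : ℝ :=
  (B : ℝ) / (1 + Real.log n) * (1 / (k : ℝ))

/-- The acceptance condition of the Modified Harmonic policy for packet `i`,
given that the previously accepted packets are `S`: compute the smallest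
threshold `T k` strictly exceeding the occupancy of queue `dest i` (as the
thresholds are decreasing in `k`, this is the largest such `k`), and accept iff
after accepting, at most `k` queues have occupancy at least `T k`. -/
def harAccepts (m n B : ℕ) (t : Fin m → ℕ) (dest : Fin m → Fin n)
    (S : Finset (Fin m)) (i : Fin m) : Prop :=
  ∃ k ∈ Finset.Icc 1 n,
    ((occ m n t dest S i (dest i) : ℝ) < thr n B k) ∧
    (∀ k' ∈ Finset.Icc 1 n,
      ((occ m n t dest S i (dest i) : ℝ) < thr n B k') → k' ≤ k) ∧
    Set.ncard {q : Fin n |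
      thr n B k ≤ ((occ m n t dest S i q + if q = dest i then 1 else 0 : ℕ) : ℝ)} ≤ k

/-- The set of packets among the first `j` packets accepted by the Modified
Harmonic policy (decisions are made online, in arrival order). -/
def harAux (m n B : ℕ) (t : Fin m → ℕ) (dest : Fin m → Fin n) : ℕ → Finset (Fin m)
  | 0 => ∅
  | j + 1 =>
    if h : j < m then
      if harAccepts m n B t dest (harAux m n B t dest j) ⟨j, h⟩ then
        insert ⟨j, h⟩ (harAux m n B t dest j)
      else harAux m n B t dest j
    else harAux m n B t dest j

/-- The set of packets accepted by the Modified Harmonic policy. -/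
def HAR (m n B : ℕ) (t : Fin m → ℕ) (dest : Fin m → Fin n) : Finset (Fin m) :=
  harAux m n B t dest m

/-- Occupancy of queue `q` under acceptance set `S` at time `s`, once the transmission of time `s`
and the arrivals of index `< i` at time `s` have been processed. -/
def lenBefore (m n : ℕ) (t : Fin m → ℕ) (dest : Fin m → Fin n)
    (S : Finset (Fin m)) (q : Fin n) (s i : ℕ) : ℕ :=
  if s = 0 then arrivalsBefore m n t dest S q 0 i
  else (lenAt m n t dest S q (s - 1) - 1) + arrivalsBefore m n t dest S q s i

/-- Number of packets of `S` destined to `q` that arrive before time `s`, or at time `s` with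
index `< i`. -/
def countBefore (m n : ℕ) (t : Fin m → ℕ) (dest : Fin m → Fin n)
    (S : Finset (Fin m)) (q : Fin n) (s i : ℕ) : ℕ :=
  (S.filter fun j => dest j = q ∧ (t j < s ∨ t j = s ∧ (j : ℕ) < i)).card

section Counting

variable {m n : ℕ} {t : Fin m → ℕ} {dest : Fin m → Fin n}

lemma arrivalsBefore_eq_card (S : Finset (Fin m)) (q : Fin n) (s i : ℕ) :
    arrivalsBefore m n t dest S q s i =
      (S.filter fun j => dest j = q ∧ t j = s ∧ (j : ℕ) < i).card := by
  rw [arrivalsBefore, ← Set.ncard_coe_finset]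
  congr 1
  ext j
  simp

lemma arrivalsBefore_zero (S : Finset (Fin m)) (q : Fin n) (s : ℕ) :
    arrivalsBefore m n t dest S q s 0 = 0 := by
  simp [arrivalsBefore_eq_card]

lemma arrivalsBefore_succ (S : Finset (Fin m)) (q : Fin n) (s : ℕ) (i : Fin m) :
    arrivalsBefore m n t dest S q s (i + 1) =
      arrivalsBefore m n t dest S q s i + if i ∈ S ∧ dest i = q ∧ t i = s then 1 else 0 := by
  simp only [arrivalsBefore_eq_card]
  split_ifs with h
  · rw [← Finset.card_insert_of_notMem (a := i) (by simp)]
    congr 1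
    ext j
    simp only [Finset.mem_filter, Finset.mem_insert, Fin.ext_iff]
    grind
  · rw [add_zero]
    congr 1
    ext j
    simp only [Finset.mem_filter]
    grind

lemma countBefore_succ (S : Finset (Fin m)) (q : Fin n) (s : ℕ) (i : Fin m) :
    countBefore m n t dest S q s (i + 1) =
      countBefore m n t dest S q s i + if i ∈ S ∧ dest i = q ∧ t i = s then 1 else 0 := by
  simp only [countBefore]
  split_ifs with h
  · rw [← Finset.card_insert_of_notMem (a := i) (by simp [h])]
    congr 1
    ext j
    simp only [Finset.mem_filter, Finset.mem_insert, Fin.ext_iff]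
    grind
  · rw [add_zero]
    congr 1
    ext j
    simp only [Finset.mem_filter]
    grind

lemma countBefore_succ_zero (S : Finset (Fin m)) (q : Fin n) (s : ℕ) :
    countBefore m n t dest S q (s + 1) 0 = countBefore m n t dest S q s m := by
  simp only [countBefore]
  congr 1
  ext j
  have := j.2
  simp only [Finset.mem_filter]
  grind

lemma lenBefore_succ (S : Finset (Fin m)) (q : Fin n) (s : ℕ) (i : Fin m) :
    lenBefore m n t dest S q s (i + 1) =
      lenBefore m n t dest S q s i + if i ∈ S ∧ dest i = q ∧ t i = s then 1 else 0 := by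
  unfold lenBefore
  split_ifs with hs <;> simp_all [arrivalsBefore_succ, add_assoc]

lemma lenAt_eq_lenBefore (S : Finset (Fin m)) (q : Fin n) (s : ℕ) :
    lenAt m n t dest S q s = lenBefore m n t dest S q s m := by
  cases s <;> simp [lenAt, lenBefore, arrivalsAt]

lemma lenBefore_succ_zero (S : Finset (Fin m)) (q : Fin n) (s : ℕ) :
    lenBefore m n t dest S q (s + 1) 0 = lenBefore m n t dest S q s m - 1 := by
  rw [← lenAt_eq_lenBefore]
  simp [lenBefore, arrivalsBefore_zero]

lemma occ_eq_lenBefore (S : Finset (Fin m)) (i : Fin m) (q : Fin n) :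
    occ m n t dest S i q = lenBefore m n t dest S q (t i) i := by
  unfold occ lenBefore
  split_ifs with h <;> simp

/-- The packets of `O \ H` arriving to a queue which is longer under `H` than under `O`. -/
def excessArrivals (m n : ℕ) (t : Fin m → ℕ) (dest : Fin m → Fin n)
    (O H : Finset (Fin m)) : Finset (Fin m) :=
  O.filter fun i => i ∉ H ∧ occ m n t dest O i (dest i) < occ m n t dest H i (dest i)

/-- The number of packets of `H \ O` exceeds that of the excess arrivals at least by the
amount by which the queue under `H` is longer than the queue under `O`. -/
lemma countBefore_excessArrivals_add_le (O H : Finset (Fin m)) (q : Fin n) (s i : ℕ)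
    (hi : i ≤ m) :
    countBefore m n t dest (excessArrivals m n t dest O H) q s i +
        (lenBefore m n t dest H q s i - lenBefore m n t dest O q s i) ≤
      countBefore m n t dest (H \ O) q s i := by
  induction s generalizing i with
  | zero =>
    induction i with
    | zero => simp [countBefore, lenBefore, arrivalsBefore_zero]
    | succ i ih => exact step 0 ⟨i, hi⟩ (ih (by omega))
  | succ s ihs =>
    induction i with
    | zero =>
      have := ihs m le_rfl
      simp only [countBefore_succ_zero, lenBefore_succ_zero]
      omega
    | succ i ih => exact step (s + 1) ⟨i, hi⟩ (ih (by omega))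
where
  step (s : ℕ) (i : Fin m)
      (ih : countBefore m n t dest (excessArrivals m n t dest O H) q s i +
          (lenBefore m n t dest H q s i - lenBefore m n t dest O q s i) ≤
        countBefore m n t dest (H \ O) q s i) :
      countBefore m n t dest (excessArrivals m n t dest O H) q s (i + 1) +
          (lenBefore m n t dest H q s (i + 1) - lenBefore m n t dest O q s (i + 1)) ≤
        countBefore m n t dest (H \ O) q s (i + 1) := by
    simp only [countBefore_succ, lenBefore_succ]
    by_cases h : dest i = q ∧ t i = s
    · obtain ⟨rfl, rfl⟩ := h
      simp only [excessArrivals, Finset.mem_filter, Finset.mem_sdiff, occ_eq_lenBefore,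
        and_true] at ih ⊢
      by_cases hO : i ∈ O <;> by_cases hH : i ∈ H <;> simp only [hO, hH] <;> grind
    · simpa [h] using ih

lemma countBefore_arrival_time (ht : Monotone t) (S : Finset (Fin m)) (q : Fin n) (i : Fin m) :
    countBefore m n t dest S q (t i) i = (S.filter fun j => dest j = q ∧ j < i).card := by
  rw [countBefore]
  congr 1
  ext j
  have h₁ : t j < t i → j < i := fun h => ht.reflect_lt h
  have h₂ : j < i → t j ≤ t i := fun h => ht h.le
  have h₃ : (j : ℕ) < i ↔ j < i := Iff.rfl
  simp only [Finset.mem_filter, h₃]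
  grind

lemma card_excessArrivals_le (ht : Monotone t) (O H : Finset (Fin m)) (i : Fin m)
    (hi : i ∈ excessArrivals m n t dest O H) :
    ((excessArrivals m n t dest O H).filter fun j => dest j = dest i ∧ j ≤ i).card ≤
      ((H \ O).filter fun j => dest j = dest i ∧ j < i).card := by
  have h := countBefore_excessArrivals_add_le (t := t) (dest := dest) O H (dest i) (t i) i i.2.le
  rw [countBefore_arrival_time ht, countBefore_arrival_time ht] at h
  have hlt := (Finset.mem_filter.1 hi).2.2
  rw [occ_eq_lenBefore, occ_eq_lenBefore] at hlt
  have hins : ((excessArrivals m n t dest O H).filter fun j => dest j = dest i ∧ j ≤ i) =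
      insert i ((excessArrivals m n t dest O H).filter fun j => dest j = dest i ∧ j < i) := by
    ext j
    simp only [Finset.mem_filter, Finset.mem_insert, le_iff_lt_or_eq]
    grind
  rw [hins, Finset.card_insert_of_notMem (by simp)]
  omega

/-- Excess arrivals can be matched injectively to earlier packets of `H \ O` with the same
destination. -/
lemma exists_injective_excessArrivals (ht : Monotone t) (O H : Finset (Fin m)) :
    ∃ g : excessArrivals m n t dest O H → Fin m, Function.Injective g ∧
      ∀ i : excessArrivals m n t dest O H,
        g i ∈ (H \ O).filter fun j => dest j = dest i ∧ j < i := by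
  rw [← Finset.all_card_le_biUnion_card_iff_exists_injective
    (fun i : excessArrivals m n t dest O H =>
      (H \ O).filter fun j => dest j = dest i ∧ j < i)]
  intro s
  rw [Finset.card_eq_sum_card_fiberwise
      (f := fun i : excessArrivals m n t dest O H => dest i) (t := Finset.univ) (by simp),
    Finset.card_eq_sum_card_fiberwise (f := dest) (t := Finset.univ) (by simp)]
  refine Finset.sum_le_sum fun q _ => ?_
  rcases (s.filter fun i : excessArrivals m n t dest O H => dest i = q).eq_empty_or_nonempty
    with he | hne
  · simp [he]
  · obtain ⟨i, hi, hmax⟩ := Finset.exists_max_image _ id hne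
    obtain ⟨his, rfl⟩ := Finset.mem_filter.1 hi
    calc (s.filter fun j : excessArrivals m n t dest O H => dest j = dest i).card
        = ((s.filter fun j : excessArrivals m n t dest O H => dest j = dest i).map
            (Function.Embedding.subtype _)).card :=
          (Finset.card_map _).symm
      _ ≤ ((excessArrivals m n t dest O H).filter fun j => dest j = dest i ∧ j ≤ (i : Fin m)).card
          := by
          refine Finset.card_le_card fun j hj => ?_
          obtain ⟨k, hk, rfl⟩ := Finset.mem_map.1 hj
          exact Finset.mem_filter.2 ⟨k.2, (Finset.mem_filter.1 hk).2, hmax k hk⟩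
      _ ≤ ((H \ O).filter fun j => dest j = dest i ∧ j < i).card :=
          card_excessArrivals_le ht O H i i.2
      _ ≤ _ := by
          refine Finset.card_le_card fun j hj => ?_
          exact Finset.mem_filter.2
            ⟨Finset.mem_biUnion.2 ⟨i, his, hj⟩, (Finset.mem_filter.1 hj).2.1⟩

end Counting

/-- Let `P_A = OPT ∩ HAR` and let `P_B` be the set of packets
`p ∈ OPT \ HAR` such that, at the time `p` arrives, the occupancy of `p`'s
destination queue in Harmonic's buffer is strictly greater than that in `OPT`'s
buffer.  Then there is an injective map `f` from `P_A ∪ P_B` into `HAR` which is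
the identity on `P_A`, and for every `p ∈ P_B`, the packet `f p` has the same
destination port as `p` and arrived strictly before `p`. -/
theorem exists_injection_PA_PB_into_HAR
    (n B m : ℕ) (hn : 1 ≤ n) (hB : 1 ≤ B)
    (t : Fin m → ℕ) (dest : Fin m → Fin n) (ht : Monotone t)
    (OPT : Finset (Fin m))
    (hOPTfeas : Feasible m n B t dest OPT)
    (hOPTopt : ∀ S : Finset (Fin m), Feasible m n B t dest S → S.card ≤ OPT.card)
    (PA PB : Finset (Fin m))
    (hPA : PA = OPT ∩ HAR m n B t dest)
    (hPB : PB = OPT.filter (fun i => i ∉ HAR m n B t dest ∧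
      occ m n t dest OPT i (dest i) < occ m n t dest (HAR m n B t dest) i (dest i))) :
    ∃ f : Fin m → Fin m,
      Set.InjOn f ↑(PA ∪ PB) ∧
      (∀ i ∈ PA ∪ PB, f i ∈ HAR m n B t dest) ∧
      (∀ i ∈ PA, f i = i) ∧
      (∀ i ∈ PB, dest (f i) = dest i ∧ f i < i) := by
  have hPB' : PB = excessArrivals m n t dest OPT (HAR m n B t dest) := hPB
  clear hPB
  subst hPA hPB'
  obtain ⟨g, hinj, hg⟩ :=
    exists_injective_excessArrivals (dest := dest) ht OPT (HAR m n B t dest)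
  simp only [Finset.mem_filter, Finset.mem_sdiff] at hg
  have hnot : ∀ i ∈ OPT ∩ HAR m n B t dest,
      i ∉ excessArrivals m n t dest OPT (HAR m n B t dest) := fun i hi h =>
    (Finset.mem_filter.1 h).2.1 (Finset.mem_inter.1 hi).2
  refine ⟨fun i => if h : i ∈ excessArrivals m n t dest OPT (HAR m n B t dest) then g ⟨i, h⟩
    else i, ?_, ?_, ?_, ?_⟩
  · intro i hi j hj hij
    simp only [Finset.coe_union, Set.mem_union, Finset.mem_coe] at hi hj
    dsimp only at hij
    split_ifs at hij with h₁ h₂ h₂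
    · exact congrArg Subtype.val (hinj hij)
    · have hO := (Finset.mem_inter.1 (hj.resolve_right h₂)).1
      exact absurd (hij ▸ hO) (hg ⟨i, h₁⟩).1.2
    · have hO := (Finset.mem_inter.1 (hi.resolve_right h₁)).1
      exact absurd (hij ▸ hO) (hg ⟨j, h₂⟩).1.2
    · exact hij
  · intro i hi
    dsimp only
    split_ifs with h
    · exact (hg ⟨i, h⟩).1.1
    · exact (Finset.mem_inter.1 ((Finset.mem_union.1 hi).resolve_right h)).2
  · intro i hi
    exact dif_neg (hnot i hi)
  · intro i hi
    simp only [dif_pos hi]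
    exact (hg ⟨i, hi⟩).2

end
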